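/- The multiplicity of the trivial character of H(n+1,q) in the permutation representation on k-dimensional subspaces of F_q^{n+1} not contained in F_q^n equals [n choose k−1]_q, i.e., the number of H(n+1,q)-orbits on such subspaces is [n choose k−1]_q. -/

import Mathlib

/-- The matrix `[[I, a], [0, 1]]` over `F`, indexed by `Fin n ⊕ Unit`. -/
def Hmat {F : Type} [Field F] {n : ℕ} (a : Fin n → F) :
    Matrix (Fin n ⊕ Unit) (Fin n ⊕ Unit) F :=
  Matrix.fromBlocks 1 (Matrix.of fun i (_ : Unit) => a i) 0 1

/-- The action of the element `[[I, a], [0, 1]]` of `H(n+1, q)` on subspaces of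
`F_q^{n+1}`. -/
def actH {F : Type} [Field F] {n : ℕ} (a : Fin n → F)
    (X : Submodule F (Fin n ⊕ Unit → F)) : Submodule F (Fin n ⊕ Unit → F) :=
  Submodule.map (Matrix.mulVecLin (Hmat a)) X

/-- The Gaussian (q-)binomial coefficient, via the q-Pascal recursion. -/
def gaussBinom (q : ℕ) : ℕ → ℕ → ℕ
  | _, 0 => 1
  | 0, _ + 1 => 0
  | n + 1, k + 1 => gaussBinom q n k + q ^ (k + 1) * gaussBinom q n (k + 1)

open Module

section GaussBinom

theorem gaussBinom_eq_zero_of_lt (q : ℕ) {n d : ℕ} (h : n < d) : gaussBinom q n d = 0 := by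
  induction n generalizing d with
  | zero =>
    obtain ⟨d, rfl⟩ := Nat.exists_eq_succ_of_ne_zero h.ne'
    simp [gaussBinom]
  | succ n ih =>
    obtain ⟨d, rfl⟩ := Nat.exists_eq_succ_of_ne_zero (Nat.ne_zero_of_lt h)
    rw [gaussBinom, ih (by omega), ih (by omega)]
    simp

theorem gaussBinom_zero_right (q n : ℕ) : gaussBinom q n 0 = 1 := by
  cases n <;> rfl

/-- Ratio of consecutive Gaussian binomial coefficients, in additive form. -/
theorem gaussBinom_succ_right_mul (q d m : ℕ) :
    ((q : ℤ) ^ (d + 1) - 1) * gaussBinom q (d + m) (d + 1) =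
      ((q : ℤ) ^ m - 1) * gaussBinom q (d + m) d := by
  obtain ⟨n, hn⟩ : ∃ n, n = d + m := ⟨_, rfl⟩
  induction n generalizing d m with
  | zero =>
    obtain ⟨rfl, rfl⟩ : d = 0 ∧ m = 0 := by omega
    simp [gaussBinom]
  | succ n ih =>
    have lhs : ((q : ℤ) ^ (d + 1) - 1) * gaussBinom q (n + 1) (d + 1) =
        ((q : ℤ) ^ (n + 1) - 1) * gaussBinom q n d := by
      rw [gaussBinom]
      push_cast
      rcases m with _ | m
      · rw [gaussBinom_eq_zero_of_lt q (show n < d by omega),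
          gaussBinom_eq_zero_of_lt q (show n < d + 1 by omega)]
        simp
      · have h := ih d m (by omega)
        obtain rfl : n = d + m := by omega
        linear_combination (q : ℤ) ^ (d + 1) * h
    have rhs : ((q : ℤ) ^ m - 1) * gaussBinom q (n + 1) d =
        ((q : ℤ) ^ (n + 1) - 1) * gaussBinom q n d := by
      rcases d with _ | d
      · obtain rfl : m = n + 1 := by omega
        simp [gaussBinom_zero_right]
      · rw [gaussBinom]
        push_cast
        have h := ih d m (by omega)
        obtain rfl : n = d + m := by omega
        linear_combination -h
    rw [← hn, lhs, rhs]

/-- The second `q`-Pascal recursion. -/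
theorem gaussBinom_succ_succ' (q d m : ℕ) :
    gaussBinom q (d + m + 1) (d + 1) =
      q ^ m * gaussBinom q (d + m) d + gaussBinom q (d + m) (d + 1) := by
  rw [gaussBinom]
  zify
  linear_combination gaussBinom_succ_right_mul q d m

end GaussBinom

section Functional

variable {F W : Type} [Field F] [AddCommGroup W] [Module F W] {φ : W →ₗ[F] F}

theorem exists_mem_map_eq_one {X : Submodule F W} (hX : ¬ X ≤ LinearMap.ker φ) :
    ∃ b ∈ X, φ b = 1 := by
  obtain ⟨x, hx, hx'⟩ := SetLike.not_le_iff_exists.1 hX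
  rw [LinearMap.mem_ker] at hx'
  exact ⟨(φ x)⁻¹ • x, X.smul_mem _ hx, by simp [hx']⟩

theorem not_le_ker_of_mem {X : Submodule F W} {b : W} (hb : b ∈ X) (h1 : φ b = 1) :
    ¬ X ≤ LinearMap.ker φ := fun h => by
  simpa [h1] using h hb

theorem inf_ker_sup_span {X : Submodule F W} {b : W} (hb : b ∈ X) (h1 : φ b = 1) :
    X ⊓ LinearMap.ker φ ⊔ F ∙ b = X := by
  apply le_antisymm
  · exact sup_le inf_le_left ((Submodule.span_singleton_le_iff_mem _ _).2 hb)
  · intro x hx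
    rw [Submodule.mem_sup]
    refine ⟨x - φ x • b, ⟨X.sub_mem hx (X.smul_mem _ hb), ?_⟩, φ x • b,
      Submodule.smul_mem _ _ (Submodule.mem_span_singleton_self b), by simp⟩
    simp [h1]

theorem sup_span_inf_ker {U : Submodule F W} {b : W} (hU : U ≤ LinearMap.ker φ) (h1 : φ b = 1) :
    (U ⊔ F ∙ b) ⊓ LinearMap.ker φ = U := by
  rw [sup_inf_assoc_of_le _ hU]
  refine sup_eq_left.2 fun x hx => ?_
  obtain ⟨hx, hx'⟩ := hx
  obtain ⟨c, rfl⟩ := Submodule.mem_span_singleton.1 hx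
  have : c = 0 := by simpa [h1] using hx'
  simp [this]

theorem card_le_eq_card_submodule (K : Submodule F W) (d : ℕ) :
    Nat.card {U : Submodule F W // U ≤ K ∧ finrank F U = d} =
      Nat.card {U : Submodule F K // finrank F U = d} := by
  symm
  refine Nat.card_congr ⟨fun U => ⟨U.1.map K.subtype, Submodule.map_subtype_le _ _, ?_⟩,
    fun U => ⟨U.1.comap K.subtype, ?_⟩, fun U => ?_, fun U => ?_⟩
  · rw [Submodule.finrank_map_subtype_eq, U.2]
  · rw [← Submodule.finrank_map_subtype_eq, Submodule.map_comap_subtype,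
      inf_eq_right.2 U.2.1, U.2.2]
  · exact Subtype.ext (Submodule.comap_map_eq_of_injective K.injective_subtype _)
  · apply Subtype.ext
    simp only [Submodule.map_comap_subtype]
    exact inf_eq_right.2 U.2.1

variable [FiniteDimensional F W]

theorem finrank_inf_ker_add_one {X : Submodule F W} (hX : ¬ X ≤ LinearMap.ker φ) :
    finrank F ↥(X ⊓ LinearMap.ker φ) + 1 = finrank F X := by
  obtain ⟨b, hb, h1⟩ := exists_mem_map_eq_one hX
  have hb0 : b ≠ 0 := by rintro rfl; simp at h1
  have h := Submodule.finrank_sup_add_finrank_inf_eq (X ⊓ LinearMap.ker φ) (F ∙ b)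
  have hbot : X ⊓ LinearMap.ker φ ⊓ F ∙ b = ⊥ := by
    refine (Submodule.eq_bot_iff _).2 fun x hx => ?_
    obtain ⟨⟨-, hx'⟩, hx⟩ := hx
    obtain ⟨c, rfl⟩ := Submodule.mem_span_singleton.1 hx
    have : c = 0 := by simpa [h1] using hx'
    simp [this]
  rw [inf_ker_sup_span hb h1, hbot, finrank_bot, finrank_span_singleton hb0] at h
  exact h.symm

theorem finrank_sup_span {U : Submodule F W} {b : W} (hU : U ≤ LinearMap.ker φ) (h1 : φ b = 1) :
    finrank F ↥(U ⊔ F ∙ b) = finrank F U + 1 := by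
  have hb : b ∈ U ⊔ F ∙ b := Submodule.mem_sup_right (Submodule.mem_span_singleton_self b)
  rw [← finrank_inf_ker_add_one (not_le_ker_of_mem hb h1), sup_span_inf_ker hU h1]

/-- A subspace not contained in `ker φ`, pointed at height one, is the same as a subspace of
`ker φ` together with a point at height one. -/
def pointedSubspaceEquiv (φ : W →ₗ[F] F) (d : ℕ) :
    {U : Submodule F W // U ≤ LinearMap.ker φ ∧ finrank F U = d} × {b : W // φ b = 1} ≃
      Σ X : {X : Submodule F W // finrank F X = d + 1 ∧ ¬ X ≤ LinearMap.ker φ},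
        {b : W // b ∈ X.1 ∧ φ b = 1} where
  toFun p :=
    have hb : p.2.1 ∈ p.1.1 ⊔ F ∙ p.2.1 :=
      Submodule.mem_sup_right (Submodule.mem_span_singleton_self _)
    ⟨⟨p.1.1 ⊔ F ∙ p.2.1, by rw [finrank_sup_span p.1.2.1 p.2.2, p.1.2.2],
      not_le_ker_of_mem hb p.2.2⟩, ⟨p.2.1, hb, p.2.2⟩⟩
  invFun p := ⟨⟨p.1.1 ⊓ LinearMap.ker φ, inf_le_right, by
    have := finrank_inf_ker_add_one p.1.2.2
    have := p.1.2.1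
    omega⟩, ⟨p.2.1, p.2.2.2⟩⟩
  left_inv := by
    rintro ⟨⟨U, hU, hd⟩, ⟨b, hb⟩⟩
    simp only [Prod.mk.injEq, Subtype.mk.injEq, and_true]
    exact sup_span_inf_ker hU hb
  right_inv := by
    rintro ⟨⟨X, hX, hd⟩, ⟨b, hb, h1⟩⟩
    have := inf_ker_sup_span hb h1
    refine Sigma.ext (Subtype.ext this) ?_
    simp only
    congr! 2
    simp [this]

/-- Translation by a point at height one. -/
def heightOneEquiv {X : Submodule F W} {b : W} (hb : b ∈ X) (h1 : φ b = 1) :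
    {x : W // x ∈ X ∧ φ x = 1} ≃ ↥(X ⊓ LinearMap.ker φ) where
  toFun x := ⟨x.1 - b, X.sub_mem x.2.1 hb, by simp [x.2.2, h1]⟩
  invFun y := ⟨y.1 + b, X.add_mem y.2.1 hb, by
    have : φ y.1 = 0 := y.2.2
    simp [this, h1]⟩
  left_inv x := by simp
  right_inv y := by simp

variable [Fintype F]

theorem card_heightOne {X : Submodule F W} (hX : ¬ X ≤ LinearMap.ker φ) {d : ℕ}
    (hd : finrank F X = d + 1) :
    Nat.card {x : W // x ∈ X ∧ φ x = 1} = Fintype.card F ^ d := by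
  obtain ⟨b, hb, h1⟩ := exists_mem_map_eq_one hX
  have := finrank_inf_ker_add_one hX
  obtain rfl : finrank F ↥(X ⊓ LinearMap.ker φ) = d := by omega
  rw [Nat.card_congr (heightOneEquiv hb h1), Module.natCard_eq_pow_finrank (K := F),
    Nat.card_eq_fintype_card]

theorem card_not_le_ker_mul {n : ℕ} (hφ : φ ≠ 0) (hn : finrank F W = n + 1) (d : ℕ) :
    Nat.card {X : Submodule F W // finrank F X = d + 1 ∧ ¬ X ≤ LinearMap.ker φ} *
        Fintype.card F ^ d =
      Nat.card {U : Submodule F W // U ≤ LinearMap.ker φ ∧ finrank F U = d} *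
        Fintype.card F ^ n := by
  have : Finite W := Module.finite_of_finite F
  have : Finite (Submodule F W) := inferInstance
  have := Fintype.ofFinite {X : Submodule F W // finrank F X = d + 1 ∧ ¬ X ≤ LinearMap.ker φ}
  have h := Nat.card_congr (pointedSubspaceEquiv φ d)
  have htop : Nat.card {b : W // φ b = 1} = Fintype.card F ^ n := by
    rw [← card_heightOne (X := (⊤ : Submodule F W)) (φ := φ) (by simpa using hφ)
      (by rw [finrank_top, hn])]
    simp
  rw [Nat.card_prod, htop, Nat.card_sigma,
    Finset.sum_congr rfl fun X _ => card_heightOne X.2.2 X.2.1] at h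
  rw [h]
  simp

end Functional

/-- The Gaussian binomial coefficient counts subspaces of a given dimension. -/
theorem card_submodule_finrank_eq_gaussBinom {F : Type} [Field F] [Fintype F] (n d : ℕ)
    (V : Type) [AddCommGroup V] [Module F V] [FiniteDimensional F V] (hV : finrank F V = n) :
    Nat.card {U : Submodule F V // finrank F U = d} = gaussBinom (Fintype.card F) n d := by
  have hzero (V : Type) [AddCommGroup V] [Module F V] [FiniteDimensional F V] :
      Nat.card {U : Submodule F V // finrank F U = 0} = 1 := by
    simp [Submodule.finrank_eq_zero]
  induction n generalizing d V with
  | zero =>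
    rcases d with _ | d
    · rw [hzero, gaussBinom_zero_right]
    · rw [gaussBinom, Nat.card_eq_zero]
      refine Or.inl ⟨fun U => ?_⟩
      have := Submodule.finrank_le U.1
      have := U.2
      omega
  | succ n ih =>
    rcases d with _ | d
    · rw [hzero, gaussBinom_zero_right]
    have : Nontrivial V := nontrivial_of_finrank_eq_succ hV
    obtain ⟨φ, hφ⟩ : ∃ φ : Module.Dual F V, φ ≠ 0 := exists_ne 0
    have hK : finrank F (LinearMap.ker φ) = n := by
      have := Module.Dual.finrank_ker_add_one_of_ne_zero hφ
      omega
    have : Finite V := Module.finite_of_finite F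
    have : Finite (Submodule F V) := inferInstance
    have hle (j : ℕ) : Nat.card {U : Submodule F V // U ≤ LinearMap.ker φ ∧ finrank F U = j} =
        gaussBinom (Fintype.card F) n j := by
      rw [card_le_eq_card_submodule, ih _ _ hK]
    have hsplit : Nat.card {U : Submodule F V // finrank F U = d + 1} =
        Nat.card {U : Submodule F V // U ≤ LinearMap.ker φ ∧ finrank F U = d + 1} +
        Nat.card {X : Submodule F V // finrank F X = d + 1 ∧ ¬ X ≤ LinearMap.ker φ} := by
      rw [← Nat.card_sum]
      classical
      rw [← Nat.card_congr (Equiv.sumCompl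
        fun U : {U : Submodule F V // finrank F U = d + 1} => U.1 ≤ LinearMap.ker φ)]
      refine Nat.card_congr (Equiv.sumCongr
        ((Equiv.subtypeSubtypeEquivSubtypeInter (fun U : Submodule F V => finrank F U = d + 1)
          fun U => U ≤ LinearMap.ker φ).trans (Equiv.subtypeEquivRight fun _ => and_comm))
        (Equiv.subtypeSubtypeEquivSubtypeInter _ fun U => ¬ U ≤ LinearMap.ker φ))
    have hcount := card_not_le_ker_mul hφ hV d
    have hq : 0 < Fintype.card F ^ d := pow_pos Fintype.card_pos _
    rw [hsplit, hle]
    rw [hle] at hcount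
    rcases lt_or_ge n d with h | h
    · rw [gaussBinom_eq_zero_of_lt _ h, zero_mul] at hcount
      rw [gaussBinom_eq_zero_of_lt _ (by omega : n < d + 1),
        gaussBinom_eq_zero_of_lt _ (by omega : n + 1 < d + 1)]
      simpa [hq.ne'] using hcount
    · obtain ⟨m, rfl⟩ := Nat.exists_eq_add_of_le h
      rw [gaussBinom_succ_succ', add_comm]
      congr 1
      apply Nat.eq_of_mul_eq_mul_right hq
      rw [hcount]
      ring

section Action

variable {F : Type} [Field F] {n : ℕ}

/-- The last coordinate. -/
abbrev lastCoord (F : Type) [Field F] (n : ℕ) : (Fin n ⊕ Unit → F) →ₗ[F] F :=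
  LinearMap.proj (R := F) (Sum.inr () : Fin n ⊕ Unit)

/-- The inclusion of `F ^ n` as the hyperplane where the last coordinate vanishes. -/
abbrev horizontal (a : Fin n → F) : Fin n ⊕ Unit → F := Sum.elim a 0

theorem Hmat_mulVec (a : Fin n → F) (x : Fin n ⊕ Unit → F) :
    (Hmat a).mulVec x = x + lastCoord F n x • horizontal a := by
  ext (i | i)
  · simp [Hmat, Matrix.mulVec, dotProduct, Matrix.one_apply, mul_comm]
  · simp [Hmat, Matrix.mulVec, dotProduct]

theorem mem_actH {a : Fin n → F} {X : Submodule F (Fin n ⊕ Unit → F)} {y : Fin n ⊕ Unit → F} :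
    y ∈ actH a X ↔ ∃ x ∈ X, x + lastCoord F n x • horizontal a = y := by
  simp only [actH, Submodule.mem_map, Matrix.mulVecLin_apply, Hmat_mulVec]

theorem actH_inf_ker (a : Fin n → F) (X : Submodule F (Fin n ⊕ Unit → F)) :
    actH a X ⊓ LinearMap.ker (lastCoord F n) = X ⊓ LinearMap.ker (lastCoord F n) := by
  ext y
  simp only [Submodule.mem_inf, mem_actH, LinearMap.mem_ker]
  constructor
  · rintro ⟨⟨x, hx, rfl⟩, h⟩
    have h0 : lastCoord F n x = 0 := by simpa using h
    simpa [h0] using hx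
  · rintro ⟨hy, h⟩
    exact ⟨⟨y, hy, by simp [h]⟩, h⟩

theorem actH_eq {a : Fin n → F} {X : Submodule F (Fin n ⊕ Unit → F)} {b : Fin n ⊕ Unit → F}
    (hb : b ∈ X) (h1 : lastCoord F n b = 1) :
    actH a X = X ⊓ LinearMap.ker (lastCoord F n) ⊔ F ∙ (b + horizontal a) := by
  have hmem : b + horizontal a ∈ actH a X := mem_actH.2 ⟨b, hb, by simp [h1]⟩
  have h1' : lastCoord F n (b + horizontal a) = 1 := by simpa using h1
  rw [← inf_ker_sup_span hmem h1', actH_inf_ker]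

theorem actH_eq_self_iff {a : Fin n → F} {X : Submodule F (Fin n ⊕ Unit → F)}
    {b : Fin n ⊕ Unit → F} (hb : b ∈ X) (h1 : lastCoord F n b = 1) :
    actH a X = X ↔ b + horizontal a ∈ X := by
  have h1' : lastCoord F n (b + horizontal a) = 1 := by simpa using h1
  rw [actH_eq hb h1]
  constructor
  · intro h
    rw [← h]
    exact Submodule.mem_sup_right (Submodule.mem_span_singleton_self _)
  · exact fun h => inf_ker_sup_span h h1'

theorem exists_eq_add_horizontal {b c : Fin n ⊕ Unit → F} (hb : lastCoord F n b = 1)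
    (hc : lastCoord F n c = 1) : ∃ a, c = b + horizontal a := by
  refine ⟨fun i => c (Sum.inl i) - b (Sum.inl i), ?_⟩
  ext (i | i)
  · simp
  · simp only [LinearMap.coe_proj, Function.eval] at hb hc
    simp [hb, hc]

theorem horizontal_injective : Function.Injective (horizontal : (Fin n → F) → _) :=
  fun _ _ h => funext fun i => congrFun h (Sum.inl i)

/-- Subspaces not in the hyperplane are in the same orbit iff they meet it in the same subspace. -/
theorem exists_eq_actH_iff {X Y : Submodule F (Fin n ⊕ Unit → F)}
    (hX : ¬ X ≤ LinearMap.ker (lastCoord F n)) :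
    (∃ a, Y = actH a X) ↔ ¬ Y ≤ LinearMap.ker (lastCoord F n) ∧
      Y ⊓ LinearMap.ker (lastCoord F n) = X ⊓ LinearMap.ker (lastCoord F n) := by
  obtain ⟨b, hb, h1⟩ := exists_mem_map_eq_one hX
  constructor
  · rintro ⟨a, rfl⟩
    refine ⟨not_le_ker_of_mem (mem_actH.2 ⟨b, hb, rfl⟩) ?_, actH_inf_ker a X⟩
    simpa using h1
  · rintro ⟨hY, h⟩
    obtain ⟨c, hc, hc1⟩ := exists_mem_map_eq_one hY
    obtain ⟨a, rfl⟩ := exists_eq_add_horizontal h1 hc1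
    exact ⟨a, by rw [actH_eq hb h1, ← h, inf_ker_sup_span hc hc1]⟩

theorem card_actH_eq_self [Fintype F] {X : Submodule F (Fin n ⊕ Unit → F)}
    (hX : ¬ X ≤ LinearMap.ker (lastCoord F n)) {d : ℕ} (hd : finrank F X = d + 1) :
    Nat.card {a : Fin n → F // actH a X = X} = Fintype.card F ^ d := by
  obtain ⟨b, hb, h1⟩ := exists_mem_map_eq_one hX
  rw [← card_heightOne hX hd]
  refine Nat.card_congr (Equiv.ofBijective
    (fun a => ⟨b + horizontal a.1, (actH_eq_self_iff hb h1).1 a.2, by simpa using h1⟩) ⟨?_, ?_⟩)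
  · intro _ _ h
    exact Subtype.ext (horizontal_injective (add_left_cancel (Subtype.ext_iff.1 h)))
  · rintro ⟨c, hc, hc1⟩
    obtain ⟨a, rfl⟩ := exists_eq_add_horizontal h1 hc1
    exact ⟨⟨a, (actH_eq_self_iff hb h1).2 hc⟩, rfl⟩

theorem card_orbits_eq_card_le_ker (d : ℕ) :
    Nat.card {s : Set (Submodule F (Fin n ⊕ Unit → F)) |
        ∃ X : Submodule F (Fin n ⊕ Unit → F), finrank F X = d + 1 ∧
          ¬ X ≤ LinearMap.ker (lastCoord F n) ∧ s = {Y | ∃ a : Fin n → F, Y = actH a X}} =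
      Nat.card {U : Submodule F (Fin n ⊕ Unit → F) //
        U ≤ LinearMap.ker (lastCoord F n) ∧ finrank F U = d} := by
  obtain ⟨e, he⟩ : ∃ e, lastCoord F n e = 1 := ⟨fun _ => 1, rfl⟩
  have hmem (U : Submodule F (Fin n ⊕ Unit → F)) : e ∈ U ⊔ F ∙ e :=
    Submodule.mem_sup_right (Submodule.mem_span_singleton_self _)
  symm
  refine Nat.card_congr (Equiv.ofBijective
    (fun U => ⟨{Y | ∃ a : Fin n → F, Y = actH a (U.1 ⊔ F ∙ e)}, _,
      by rw [finrank_sup_span U.2.1 he, U.2.2], not_le_ker_of_mem (hmem _) he, rfl⟩) ⟨?_, ?_⟩)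
  · intro U U' h
    have h : {Y | ∃ a : Fin n → F, Y = actH a (U.1 ⊔ F ∙ e)} =
        {Y | ∃ a : Fin n → F, Y = actH a (U'.1 ⊔ F ∙ e)} := Subtype.ext_iff.1 h
    have hself : U.1 ⊔ F ∙ e ∈
        {Y | ∃ a : Fin n → F, Y = actH a (U.1 ⊔ F ∙ e)} :=
      (exists_eq_actH_iff (not_le_ker_of_mem (hmem _) he)).2
        ⟨not_le_ker_of_mem (hmem _) he, rfl⟩
    rw [h] at hself
    have := ((exists_eq_actH_iff (not_le_ker_of_mem (hmem _) he)).1 hself).2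
    rw [sup_span_inf_ker U.2.1 he, sup_span_inf_ker U'.2.1 he] at this
    exact Subtype.ext this
  · rintro ⟨_, X, hd, hX, rfl⟩
    refine ⟨⟨X ⊓ LinearMap.ker (lastCoord F n), inf_le_right, ?_⟩,
      Subtype.ext (Set.ext fun Y => ?_)⟩
    · have := finrank_inf_ker_add_one hX
      omega
    · simp only [Set.mem_ofPred_eq]
      rw [exists_eq_actH_iff (not_le_ker_of_mem (hmem _) he), exists_eq_actH_iff hX,
        sup_span_inf_ker inf_le_right he]

theorem sum_card_actH_eq_self [Fintype F] (d : ℕ) :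
    ∑ a : Fin n → F, Nat.card {X : Submodule F (Fin n ⊕ Unit → F) //
        finrank F X = d + 1 ∧ ¬ X ≤ LinearMap.ker (lastCoord F n) ∧ actH a X = X} =
      Nat.card {X : Submodule F (Fin n ⊕ Unit → F) //
        finrank F X = d + 1 ∧ ¬ X ≤ LinearMap.ker (lastCoord F n)} * Fintype.card F ^ d := by
  have := Fintype.ofFinite {X : Submodule F (Fin n ⊕ Unit → F) //
    finrank F X = d + 1 ∧ ¬ X ≤ LinearMap.ker (lastCoord F n)}
  trans ∑ X : {X : Submodule F (Fin n ⊕ Unit → F) //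
      finrank F X = d + 1 ∧ ¬ X ≤ LinearMap.ker (lastCoord F n)},
    Nat.card {a : Fin n → F // actH a X.1 = X.1}
  · rw [← Nat.card_sigma, ← Nat.card_sigma]
    exact Nat.card_congr
      ⟨fun p => ⟨⟨p.2.1, p.2.2.1, p.2.2.2.1⟩, ⟨p.1, p.2.2.2.2⟩⟩,
        fun p => ⟨p.2.1, ⟨p.1.1, p.1.2.1, p.1.2.2, p.2.2⟩⟩, fun _ => rfl, fun _ => rfl⟩
  · rw [Finset.sum_congr rfl fun X _ => card_actH_eq_self X.2.2 X.2.1]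
    simp

end Action

/-- The multiplicity of the trivial character of `H(n+1, q) ≅ (F_q^n, +)` in the
permutation representation on `k`-dimensional subspaces of `F_q^{n+1}` not contained in
`F_q^n` is `[n, k-1]_q`; i.e. the number of `H(n+1, q)`-orbits on such subspaces is
`[n, k-1]_q`. -/
theorem multiplicity_trivial_char (F : Type) [Field F] [Fintype F] (n k : ℕ)
    (hn : 1 ≤ n) (hk1 : 1 ≤ k) (hk2 : k ≤ n + 1)
    (Hyp : Submodule F (Fin n ⊕ Unit → F))
    (hHyp : Hyp = LinearMap.ker (LinearMap.proj (R := F) (Sum.inr () : Fin n ⊕ Unit))) :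
    (1 / (Fintype.card F : ℚ) ^ n) *
        ∑ a : Fin n → F,
          (Nat.card {X : Submodule F (Fin n ⊕ Unit → F) //
            Module.finrank F ↥X = k ∧ ¬ X ≤ Hyp ∧ actH a X = X} : ℚ) =
      (gaussBinom (Fintype.card F) n (k - 1) : ℚ) ∧
    Nat.card {s : Set (Submodule F (Fin n ⊕ Unit → F)) |
        ∃ X : Submodule F (Fin n ⊕ Unit → F),
          Module.finrank F ↥X = k ∧ ¬ X ≤ Hyp ∧ s = {Y | ∃ a : Fin n → F, Y = actH a X}} =
      gaussBinom (Fintype.card F) n (k - 1) := by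
  subst hHyp
  obtain ⟨d, rfl⟩ := Nat.exists_eq_add_of_le' hk1
  rw [Nat.add_sub_cancel]
  have hφ : lastCoord F n ≠ 0 := fun h => by
    simpa using LinearMap.congr_fun h (fun _ => 1)
  have hfin : finrank F (Fin n ⊕ Unit → F) = n + 1 := by simp
  have hK : finrank F (LinearMap.ker (lastCoord F n)) = n := by
    have := Module.Dual.finrank_ker_add_one_of_ne_zero (f := lastCoord F n) hφ
    omega
  have hU : Nat.card {U : Submodule F (Fin n ⊕ Unit → F) //
      U ≤ LinearMap.ker (lastCoord F n) ∧ finrank F U = d} =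
        gaussBinom (Fintype.card F) n d := by
    rw [card_le_eq_card_submodule, card_submodule_finrank_eq_gaussBinom n d _ hK]
  refine ⟨?_, (card_orbits_eq_card_le_ker d).trans hU⟩
  have hq : (Fintype.card F : ℚ) ^ n ≠ 0 := pow_ne_zero _ (by simp)
  rw [← Nat.cast_sum, sum_card_actH_eq_self, card_not_le_ker_mul hφ hfin, hU]
  push_cast
  field_simp
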